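/- Let α be a real algebraic number that is totally real and whose splitting field (the splitting field over ℚ of its minimal polynomial) has degree 2^a·3^b over ℚ for some nonnegative integers a and b. Then there exists a tower of subfields ℚ = F₀ ⊆ F₁ ⊆ ⋯ ⊆ Fₙ of ℝ with α ∈ Fₙ such that each Fᵢ is totally real and for each i either (i) [Fᵢ₊₁ : Fᵢ] = 2 and Fᵢ₊₁ = Fᵢ(√aᵢ) for some totally positive element aᵢ ∈ Fᵢ, or (ii) [Fᵢ₊₁ : Fᵢ] = 3 and Fᵢ₊₁ = Fᵢ(βᵢ) where βᵢ ∈ ℝ is a root of the trisection polynomial 4X³ − 3X − uᵢ for some uᵢ ∈ Fᵢ with |uᵢ| ≤ 1. -/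

import Mathlib

/-- The degree of an extension of subfields of ℝ, via the inclusion map. -/
noncomputable def Subfield.relDegree {E F : Subfield ℝ} (h : E ≤ F) : ℕ :=
  letI : Algebra E F := (Subfield.inclusion h).toAlgebra
  letI : Module E F := Algebra.toModule
  Module.finrank E F

theorem aux_mean {ι : Type*} [Fintype ι] [Nonempty ι] (f : ι → ℂ) (n : ℕ) (hn : 0 < n)
    (hf : ∀ i, f i ^ n = 1) (hint : IsIntegral ℤ ((∑ i, f i) / (Fintype.card ι : ℂ)))
    (h0 : ∑ i, f i ≠ 0) : ∃ l : ℂ, ∀ i, f i = l := by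
  classical
  set d : ℂ := (Fintype.card ι : ℂ) with hd
  have hdpos : (0:ℝ) < Fintype.card ι := by exact_mod_cast Fintype.card_pos
  have hd0 : d ≠ 0 := by rw [hd]; exact_mod_cast Fintype.card_ne_zero
  have hbound : ∀ g : ι → ℂ, (∀ i, g i ^ n = 1) → ‖(∑ i, g i) / d‖ ≤ 1 := by
    intro g hg
    rw [norm_div, hd, Complex.norm_natCast, div_le_one hdpos]
    refine (norm_sum_le _ _).trans ?_
    have : ∀ i, ‖g i‖ = 1 := fun i => Complex.norm_eq_one_of_pow_eq_one (hg i) hn.ne'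
    simp [this]
  have hfi : ∀ i, IsIntegral ℚ (f i) := fun i => by
    refine ⟨Polynomial.X ^ n - 1, Polynomial.monic_X_pow_sub_C _ hn.ne', ?_⟩
    simp [hf i]
  let K : IntermediateField ℚ ℂ := IntermediateField.adjoin ℚ (Set.range f)
  have : FiniteDimensional ℚ K := by
    apply IntermediateField.finiteDimensional_adjoin
    rintro x ⟨i, rfl⟩
    exact hfi i
  have : NumberField K := {}
  let F : ι → K := fun i => ⟨f i, IntermediateField.subset_adjoin _ _ ⟨i, rfl⟩⟩
  let x : K := (∑ i, F i) / (Fintype.card ι : K)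
  have hx : (x : ℂ) = (∑ i, f i) / d := by simp [x, F, hd]
  have hx0 : x ≠ 0 := by
    intro h
    have : (x : ℂ) = 0 := by rw [h]; rfl
    rw [hx] at this
    exact (div_ne_zero h0 hd0) this
  have hxi : IsIntegral ℤ x := by
    rw [← hx] at hint
    exact (isIntegral_algHom_iff (K.val.restrictScalars ℤ) K.val.injective).1 hint
  obtain ⟨m, hm, hxm⟩ := NumberField.Embeddings.pow_eq_one_of_norm_le_one K ℂ hx0 hxi (by
    intro φ
    have : φ x = (∑ i, φ (F i)) / d := by simp [x, hd]
    rw [this]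
    apply hbound
    intro i
    rw [← map_pow, show F i ^ n = 1 from Subtype.ext (by simpa [F] using hf i), map_one])
  set a : ℂ := (∑ i, f i) / d with ha
  have han : ‖a‖ = 1 := by
    apply Complex.norm_eq_one_of_pow_eq_one (n := m) _ hm.ne'
    rw [← hx]; exact_mod_cast congrArg (fun y : K => (y : ℂ)) hxm
  refine ⟨a, ?_⟩
  have haa : a * (starRingEnd ℂ) a = 1 := by
    rw [Complex.mul_conj, Complex.normSq_eq_norm_sq, han]; simp
  have hre : ∀ i, ‖f i * (starRingEnd ℂ) a‖ = 1 := fun i => by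
    rw [norm_mul, RCLike.norm_conj, han, Complex.norm_eq_one_of_pow_eq_one (hf i) hn.ne', mul_one]
  have hsum : ∑ i, (1 - (f i * (starRingEnd ℂ) a).re) = 0 := by
    rw [Finset.sum_sub_distrib, ← Complex.re_sum, ← Finset.sum_mul,
      show ∑ i, f i = d * a by rw [ha]; field_simp, mul_assoc, haa]
    simp [hd]
  have hz := (Finset.sum_eq_zero_iff_of_nonneg (fun i _ => by
    have := Complex.re_le_norm (f i * (starRingEnd ℂ) a)
    rw [hre] at this; linarith)).1 hsum
  intro i
  have h1 : (f i * (starRingEnd ℂ) a).re = 1 := by have := hz i (Finset.mem_univ _); linarith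
  have h2 : f i * (starRingEnd ℂ) a = 1 := by
    have h3 := hre i
    have h4 := Complex.sq_norm (f i * (starRingEnd ℂ) a)
    rw [h3, Complex.normSq_apply, h1] at h4
    apply Complex.ext
    · simpa using h1
    · simp only [Complex.one_im]; nlinarith
  calc f i = f i * (starRingEnd ℂ a) * a := by rw [mul_assoc, mul_comm _ a, haa, mul_one]
    _ = a := by rw [h2, one_mul]

theorem aux_roots {d : ℕ} (M : Matrix (Fin d) (Fin d) ℂ) (n : ℕ) (hM : M ^ n = 1)
    {x : ℂ} (hx : x ∈ M.charpoly.roots) : x ^ n = 1 := by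
  have h1 : x ∈ spectrum ℂ M := Matrix.mem_spectrum_of_isRoot_charpoly (Polynomial.isRoot_of_mem_roots hx)
  have h2 := spectrum.pow_mem_pow M n h1
  rw [hM] at h2
  have : Nontrivial (Matrix (Fin d) (Fin d) ℂ) := by
    by_contra h
    rw [not_nontrivial_iff_subsingleton] at h
    have := spectrum.of_subsingleton (R := ℂ) M
    rw [this] at h1; exact h1
  rw [spectrum.one_eq] at h2
  simpa using h2

theorem aux_tr_int {d : ℕ} (M : Matrix (Fin d) (Fin d) ℂ) (n : ℕ) (hn : 0 < n) (hM : M ^ n = 1) :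
    IsIntegral ℤ M.trace := by
  rw [Matrix.trace_eq_sum_roots_charpoly]
  apply IsIntegral.multiset_sum
  intro x hx
  refine ⟨Polynomial.X ^ n - 1, Polynomial.monic_X_pow_sub_C _ hn.ne', ?_⟩
  simp [aux_roots M n hM hx]

theorem aux_scalar {d : ℕ} (hd : 0 < d) (M : Matrix (Fin d) (Fin d) ℂ) (n : ℕ) (hn : 0 < n)
    (hM : M ^ n = 1) (hint : IsIntegral ℤ (M.trace / (d : ℂ))) (h0 : M.trace ≠ 0) :
    ∃ l : ℂ, M = algebraMap ℂ _ l := by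
  classical
  have htr := Matrix.trace_eq_sum_roots_charpoly M
  have hsplit : M.charpoly.Splits := IsAlgClosed.splits _
  have hcard : M.charpoly.roots.card = d := by
    rw [← hsplit.natDegree_eq_card_roots, Matrix.charpoly_natDegree_eq_dim, Fintype.card_fin]
  obtain ⟨l, hl⟩ : ∃ l, ∀ x ∈ M.charpoly.roots, x = l := by
    have hpow : ∀ x ∈ M.charpoly.roots, x ^ n = 1 := fun x hx => aux_roots M n hM hx
    generalize M.charpoly.roots = s at *
    have hc : Fintype.card s = d := by rw [Multiset.card_coe, hcard]
    have hne : Nonempty s := Fintype.card_pos_iff.1 (by omega)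
    have hs : ∑ i : s, (i : ℂ) = M.trace := by
      rw [htr]
      conv_rhs => rw [← Multiset.map_univ_coe s]
      rfl
    obtain ⟨l, hl⟩ := aux_mean (fun i : s => (i : ℂ)) n hn
      (fun i => hpow _ Multiset.coe_mem) (by rw [hs, hc]; exact hint) (by rw [hs]; exact h0)
    refine ⟨l, fun x hx => ?_⟩
    exact hl ⟨x, ⟨0, Multiset.count_pos.2 hx⟩⟩
  have hcp : M.charpoly = (Polynomial.X - Polynomial.C l) ^ d := by
    rw [hsplit.eq_prod_roots_of_monic (Matrix.charpoly_monic M), Multiset.eq_replicate.2 ⟨hcard, hl⟩]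
    simp
  have h1 : minpoly ℂ M ∣ (Polynomial.X - Polynomial.C l) ^ d := by
    rw [← hcp]; exact minpoly.dvd _ _ (Matrix.aeval_self_charpoly M)
  have h2 : minpoly ℂ M ∣ Polynomial.X ^ n - 1 := minpoly.dvd _ _ (by simp [hM])
  have hsq : Squarefree (minpoly ℂ M) := by
    refine Squarefree.squarefree_of_dvd h2 ?_
    apply Polynomial.Separable.squarefree
    apply Polynomial.X_pow_sub_one_separable_iff.2
    exact_mod_cast hn.ne'
  have h3 := (hsq.dvd_pow_iff_dvd hd.ne').1 h1
  refine ⟨l, ?_⟩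
  have h4 : Polynomial.aeval M (Polynomial.X - Polynomial.C l) = 0 := by
    obtain ⟨q, hq⟩ := h3
    rw [hq, map_mul, minpoly.aeval, zero_mul]
  simpa [sub_eq_zero] using h4

theorem aux_rep_scalar {G : Type*} [Group G] [Fintype G] {d : ℕ} (hd : 0 < d)
    (ρ : G →* Matrix (Fin d) (Fin d) ℂ)
    (hirr : ∀ M : Matrix (Fin d) (Fin d) ℂ, (∀ h, Commute (ρ h) M) → ∃ l : ℂ, M = algebraMap ℂ _ l)
    (g : G) (C : Finset G) (hC : ∀ x, x ∈ C ↔ IsConj g x) (hcop : Nat.Coprime C.card d)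
    (h0 : (ρ g).trace ≠ 0) : ∃ l : ℂ, ρ g = algebraMap ℂ _ l := by
  classical
  have hne : NeZero d := ⟨hd.ne'⟩
  have hpow : ρ g ^ (Fintype.card G) = 1 := by rw [← map_pow, pow_card_eq_one, map_one]
  have htrint := aux_tr_int (ρ g) _ Fintype.card_pos hpow
  refine aux_scalar hd (ρ g) _ Fintype.card_pos hpow ?_ h0
  let Z : Matrix (Fin d) (Fin d) ℂ := ∑ c ∈ C, ρ c
  obtain ⟨w, hw⟩ := hirr Z (by
    intro h
    change ρ h * Z = Z * ρ h
    simp only [Z, Finset.mul_sum, Finset.sum_mul, ← map_mul]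
    refine Finset.sum_bij (fun c _ => h * c * h⁻¹) ?_ ?_ ?_ ?_
    · intro c hc
      rw [hC] at hc ⊢
      exact hc.trans (isConj_iff.2 ⟨h, rfl⟩)
    · intro a _ b _ hab
      simpa using hab
    · intro b hb
      refine ⟨h⁻¹ * b * h, ?_, by group⟩
      rw [hC] at hb ⊢
      exact hb.trans (isConj_iff.2 ⟨h⁻¹, by group⟩)
    · intro a _
      congr 1; group)
  have hZint : IsIntegral ℤ Z := by
    let φ : MonoidAlgebra ℤ G →ₐ[ℤ] Matrix (Fin d) (Fin d) ℂ := MonoidAlgebra.lift ℤ _ G ρ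
    have hφ : φ (∑ c ∈ C, MonoidAlgebra.of ℤ G c) = Z := by
      simp [φ, Z]
    rw [← hφ]
    exact (IsIntegral.of_finite ℤ _).map φ
  have hwint : IsIntegral ℤ w := by
    rw [hw] at hZint
    exact (isIntegral_algHom_iff ((Algebra.ofId ℂ (Matrix (Fin d) (Fin d) ℂ)).restrictScalars ℤ)
      (FaithfulSMul.algebraMap_injective ℂ _)).1 hZint
  have htr : (C.card : ℂ) * (ρ g).trace = d * w := by
    have h1 : Z.trace = (C.card : ℂ) * (ρ g).trace := by
      simp only [Z, Matrix.trace_sum]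
      rw [Finset.sum_congr rfl (g := fun _ => (ρ g).trace), Finset.sum_const, nsmul_eq_mul]
      intro c hc
      obtain ⟨h, hh⟩ := isConj_iff.1 ((hC c).1 hc)
      rw [← hh, map_mul, Matrix.trace_mul_comm, ← map_mul]
      congr 2; group
    rw [← h1, hw, Matrix.algebraMap_eq_diagonal, Matrix.trace_diagonal]
    simp
  have hb := Nat.isCoprime_iff_coprime.2 hcop
  obtain ⟨u, v, huv⟩ := hb
  have huv' : (u : ℂ) * C.card + v * d = 1 := by exact_mod_cast congrArg (fun z : ℤ => (z : ℂ)) huv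
  have hd0 : (d : ℂ) ≠ 0 := by exact_mod_cast hd.ne'
  have : (ρ g).trace / d = u * w + v * (ρ g).trace := by
    field_simp
    linear_combination (-(ρ g).trace) * huv' + u * htr
  rw [this]
  have hz : ∀ z : ℤ, IsIntegral ℤ (z : ℂ) := fun z => isIntegral_algebraMap (R := ℤ) (A := ℂ) (x := z)
  exact ((hz u).mul hwint).add ((hz v).mul htrint)

theorem aux_trace_pi {k : ℕ} (d : Fin k → ℕ) (x : Π i, Matrix (Fin (d i)) (Fin (d i)) ℂ) :
    LinearMap.trace ℂ _ (LinearMap.mulLeft ℂ x) = ∑ i, (d i : ℂ) * (x i).trace := by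
  classical
  rw [LinearMap.trace_eq_matrix_trace ℂ (Pi.basis fun i => Matrix.stdBasis ℂ (Fin (d i)) (Fin (d i)))]
  simp only [Matrix.trace, Matrix.diag, LinearMap.toMatrix_apply, Pi.basis_repr, Pi.basis_apply,
    LinearMap.mulLeft_apply, Pi.mul_apply, Pi.single_eq_same, Fintype.sum_sigma,
    Fintype.sum_prod_type, Matrix.stdBasis_eq_single]
  refine Finset.sum_congr rfl fun i _ => ?_
  have : ∀ (M : Matrix (Fin (d i)) (Fin (d i)) ℂ) a b,
    (Matrix.stdBasis ℂ (Fin (d i)) (Fin (d i))).repr M (a, b) = M a b := by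
    intro M a b
    rfl
  simp [this, Finset.mul_sum]

theorem aux_trace_group {G : Type*} [Group G] [Fintype G] (g : G) (hg : g ≠ 1) :
    LinearMap.trace ℂ _ (LinearMap.mulLeft ℂ (MonoidAlgebra.of ℂ G g)) = 0 := by
  classical
  rw [LinearMap.trace_eq_matrix_trace ℂ (MonoidAlgebra.basis G ℂ)]
  simp only [Matrix.trace, Matrix.diag, LinearMap.toMatrix_apply]
  apply Finset.sum_eq_zero
  intro h _
  simp [MonoidAlgebra.basis, MonoidAlgebra.single_mul_single, hg]

theorem aux_exists_rep {G : Type*} [Group G] [Fintype G] (g : G) (hg : g ≠ 1)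
    (C : Finset G) (hC : ∀ x, x ∈ C ↔ IsConj g x) (p k : ℕ) (hp : p.Prime) (hCp : C.card = p ^ k) :
    ∃ (d : ℕ) (ρ : G →* Matrix (Fin d) (Fin d) ℂ), (∃ h, ρ h ≠ 1) ∧
      ∃ l : ℂ, ρ g = algebraMap ℂ _ l := by
  classical
  obtain ⟨n, d, hd, ⟨e⟩⟩ :=
    IsSemisimpleRing.exists_algEquiv_pi_matrix_of_isAlgClosed ℂ (MonoidAlgebra ℂ G)
  by_contra hcon
  push Not at hcon
  let π : ∀ i, MonoidAlgebra ℂ G →ₐ[ℂ] Matrix (Fin (d i)) (Fin (d i)) ℂ :=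
    fun i => (Pi.evalAlgHom ℂ _ i).comp e.toAlgHom
  have hπ : ∀ i x, π i x = e x i := fun i x => rfl
  have hsurj : ∀ i, Function.Surjective (π i) := fun i M => by
    refine ⟨e.symm (Pi.single i M), ?_⟩
    simp [hπ]
  let ρ : ∀ i, G →* Matrix (Fin (d i)) (Fin (d i)) ℂ :=
    fun i => (π i : MonoidAlgebra ℂ G →* _).comp (MonoidAlgebra.of ℂ G)
  have hρ : ∀ i h, ρ i h = e (MonoidAlgebra.of ℂ G h) i := fun i x => rfl
  -- commuting with the image of `G` means commuting with everything
  have hcomm : ∀ i M, (∀ h, Commute (ρ i h) M) → ∀ N, Commute N M := by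
    intro i M hM N
    obtain ⟨x, rfl⟩ := hsurj i N
    induction x using MonoidAlgebra.induction_on with
    | of h => exact hM h
    | add x y hx hy => rw [map_add]; exact hx.add_left hy
    | smul r x hx => rw [map_smul]; exact hx.smul_left r
  have hirr : ∀ i M, (∀ h, Commute (ρ i h) M) → ∃ l : ℂ, M = algebraMap ℂ _ l := by
    intro i M hM
    have := hcomm i M hM
    obtain ⟨l, hl⟩ := Matrix.mem_range_scalar_iff_commute_single'.2 (fun a b => this (Matrix.single a b 1))
    exact ⟨l, hl.symm⟩
  have hterm : ∀ i, (∃ h, ρ i h ≠ 1) → p ∣ d i ∨ (ρ i g).trace = 0 := by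
    rintro i ⟨h, hh⟩
    by_contra hn
    push Not at hn
    obtain ⟨l, hl⟩ := aux_rep_scalar (Nat.pos_of_ne_zero (hd i).out) (ρ i) (hirr i) g C hC
      (by rw [hCp]; exact Nat.Coprime.pow_left _ ((Nat.Prime.coprime_iff_not_dvd hp).2 hn.1)) hn.2
    exact hcon _ (ρ i) ⟨h, hh⟩ l hl
  -- the sum over the regular representation
  have hsum : ∑ i, (d i : ℂ) * (ρ i g).trace = 0 := by
    rw [← aux_trace_group g hg, ← LinearMap.trace_conj' (LinearMap.mulLeft ℂ _) e.toLinearEquiv]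
    rw [show (e.toLinearEquiv.conj (LinearMap.mulLeft ℂ (MonoidAlgebra.of ℂ G g)))
      = LinearMap.mulLeft ℂ (e (MonoidAlgebra.of ℂ G g)) from ?_, aux_trace_pi]
    · rfl
    · refine LinearMap.ext fun y => ?_
      simp [LinearEquiv.conj_apply]
  -- the trivial representation
  obtain ⟨i0, hi0⟩ : ∃ i, ∀ h, ρ i h = 1 := by
    let s : MonoidAlgebra ℂ G := ∑ h, MonoidAlgebra.of ℂ G h
    have hs0 : s ≠ 0 := by
      intro h0
      have h1 := congrArg (MonoidAlgebra.lift ℂ ℂ G (1 : G →* ℂ)) h0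
      simp [s] at h1
    have hs1 : ∀ h, MonoidAlgebra.of ℂ G h * s = s := by
      intro h
      simp only [s, Finset.mul_sum, ← map_mul]
      exact Fintype.sum_equiv (Equiv.mulLeft h) _ _ (fun _ => rfl)
    have hs2 : ∀ h, s * MonoidAlgebra.of ℂ G h = s := by
      intro h
      simp only [s, Finset.sum_mul, ← map_mul]
      exact Fintype.sum_equiv (Equiv.mulRight h) _ _ (fun _ => rfl)
    have : ∃ i, π i s ≠ 0 := by
      by_contra hno
      push Not at hno
      exact hs0 (e.injective (by ext1 i; rw [map_zero]; exact hno i))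
    obtain ⟨i, hi⟩ := this
    refine ⟨i, fun h => ?_⟩
    have hl1 : ρ i h * π i s = π i s := by
      change π i _ * π i s = _
      rw [← map_mul, hs1]
    obtain ⟨l, hl⟩ := hirr i (π i s) (by
      intro h
      change π i _ * π i s = π i s * π i _
      rw [← map_mul, ← map_mul, hs1, hs2])
    have hl0 : l ≠ 0 := by
      rintro rfl
      exact hi (by rw [hl, map_zero])
    rw [hl, Algebra.algebraMap_eq_smul_one, mul_smul_comm, mul_one] at hl1
    exact smul_right_injective _ hl0 hl1
  have htriv : ∀ i, (∀ h, ρ i h = 1) → ∀ x, π i x =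
      algebraMap ℂ _ (MonoidAlgebra.lift ℂ ℂ G (1 : G →* ℂ) x) := by
    intro i hi x
    induction x using MonoidAlgebra.induction_on with
    | of h => 
      change ρ i h = _
      rw [hi]; simp
    | add x y hx hy => rw [map_add, map_add, map_add, hx, hy]
    | smul r x hx => rw [map_smul, map_smul, hx, Algebra.algebraMap_eq_smul_one,
        Algebra.algebraMap_eq_smul_one, smul_eq_mul, mul_smul]
  have huniq : ∀ i, (∀ h, ρ i h = 1) → i = i0 := by
    intro i hi
    by_contra hne
    have h1 := htriv i hi (e.symm (Pi.single i 1))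
    have h2 := htriv i0 hi0 (e.symm (Pi.single i 1))
    have := hd i
    have := hd i0
    rw [hπ, AlgEquiv.apply_symm_apply, Pi.single_eq_same] at h1
    rw [hπ, AlgEquiv.apply_symm_apply, Pi.single_eq_of_ne (Ne.symm hne)] at h2
    have h3 := (map_eq_zero_iff _ (FaithfulSMul.algebraMap_injective ℂ _)).1 h2.symm
    rw [h3, map_zero] at h1
    exact one_ne_zero h1
  have hd1 : d i0 = 1 := by
    have := hd i0
    by_contra hne
    have h2 : 1 < d i0 := by have := (hd i0).out; omega
    obtain ⟨x, hx⟩ := hsurj i0 (Matrix.single ⟨0, by omega⟩ ⟨1, h2⟩ 1)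
    rw [htriv i0 hi0] at hx
    have h3 := congrFun (congrFun hx ⟨0, by omega⟩) ⟨1, h2⟩
    rw [Matrix.algebraMap_matrix_apply] at h3
    simp at h3
  rw [← Finset.add_sum_erase _ _ (Finset.mem_univ i0), hi0 g, Matrix.trace_one,
    Fintype.card_fin, hd1] at hsum
  have hZ : ∀ i ∈ Finset.univ.erase i0, ∃ z : ℂ, IsIntegral ℤ z ∧
      (d i : ℂ) * (ρ i g).trace = p * z := by
    intro i hi
    have hi' : ∃ h, ρ i h ≠ 1 := by
      by_contra hno
      push Not at hno
      exact (Finset.ne_of_mem_erase hi) (huniq i hno)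
    rcases hterm i hi' with ⟨c, hc⟩ | h
    · refine ⟨c * (ρ i g).trace, ?_, by rw [← mul_assoc, ← Nat.cast_mul, ← hc]⟩
      have hpow : ρ i g ^ (Fintype.card G) = 1 := by rw [← map_pow, pow_card_eq_one, map_one]
      refine IsIntegral.mul ?_ (aux_tr_int _ _ Fintype.card_pos hpow)
      exact_mod_cast isIntegral_algebraMap (R := ℤ) (A := ℂ) (x := (c : ℤ))
    · exact ⟨0, isIntegral_zero, by rw [h]; ring⟩
  choose! z hz1 hz2 using hZ
  rw [Finset.sum_congr rfl hz2, ← Finset.mul_sum] at hsum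
  have hzi : IsIntegral ℤ (∑ i ∈ Finset.univ.erase i0, z i) := IsIntegral.sum _ hz1
  have hp0 : (p : ℂ) ≠ 0 := by exact_mod_cast hp.ne_zero
  have heq : (∑ i ∈ Finset.univ.erase i0, z i) = algebraMap ℚ ℂ (-1 / p) := by
    simp only [map_div₀, map_neg, map_one, map_natCast]
    field_simp
    push_cast at hsum
    linear_combination hsum
  rw [heq] at hzi
  have hq : IsIntegral ℤ (-1 / p : ℚ) :=
    (isIntegral_algHom_iff ((Algebra.ofId ℚ ℂ).restrictScalars ℤ) (algebraMap ℚ ℂ).injective).1 hzi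
  obtain ⟨m, hm⟩ := IsIntegrallyClosed.isIntegral_iff.1 hq
  have hpq : (p : ℚ) ≠ 0 := by exact_mod_cast hp.ne_zero
  have : (m : ℚ) * p = -1 := by
    have hm' : (m : ℚ) = -1 / p := hm
    rw [hm']; field_simp
  have h5 : m * p = -1 := by exact_mod_cast this
  have h6 : (p : ℤ) ∣ 1 := ⟨-m, by linarith⟩
  exact hp.one_lt.ne' (by exact_mod_cast Int.eq_one_of_dvd_one (by positivity) h6)

theorem aux_normal_of_simple {G : Type*} [Group G] [Finite G] {q p : ℕ} (hq : q.Prime) (hp : p.Prime)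
    (hqG : q ∣ Nat.card G) (hpq : ∀ r : ℕ, r.Prime → r ∣ Nat.card G → r = q ∨ r = p)
    (hsimple : ∀ N : Subgroup G, N.Normal → N = ⊥ ∨ N = ⊤) : Group.IsSolvable G := by
  classical
  have := Fintype.ofFinite G
  have : Fact q.Prime := ⟨hq⟩
  obtain ⟨P⟩ : Nonempty (Sylow q G) := inferInstance
  have hPn : Nontrivial P := by
    rw [← Finite.one_lt_card_iff_nontrivial]
    have h1 := P.dvd_card_of_dvd_card hqG
    exact lt_of_lt_of_le hq.one_lt (Nat.le_of_dvd Nat.card_pos h1)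
  have hcn : Nontrivial (Subgroup.center P) := P.isPGroup'.center_nontrivial
  obtain ⟨⟨z, hzc⟩, hz1⟩ := exists_ne (1 : Subgroup.center P)
  let g : G := z
  have hg : g ≠ 1 := by
    intro h
    apply hz1
    apply Subtype.ext
    apply Subtype.ext
    exact h
  have hPle : (P : Subgroup G) ≤ Subgroup.centralizer {g} := by
    intro x hx
    rw [Subgroup.mem_centralizer_singleton_iff]
    exact congrArg Subtype.val (Subgroup.mem_center_iff.1 hzc ⟨x, hx⟩)
  let C : Finset G := Finset.univ.filter fun x => IsConj g x
  have hC : ∀ x, x ∈ C ↔ IsConj g x := fun x => by simp [C]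
  have hCcard : C.card = (Subgroup.centralizer {g}).index := by
    have h1 : MulAction.orbit (ConjAct G) g = (C : Set G) := by
      ext x
      rw [ConjAct.mem_orbit_conjAct, isConj_comm]
      simp [hC]
    have h2 := MulAction.index_stabilizer (ConjAct G) g
    rw [h1, Set.ncard_coe_finset] at h2
    have h3 := (MulAction.stabilizer (ConjAct G) g).card_mul_index
    have h4 := (Subgroup.centralizer {g}).card_mul_index
    rw [← Subgroup.nat_card_centralizer_nat_card_stabilizer, h2] at h3
    have h5 : Nat.card (ConjAct G) = Nat.card G := rfl
    rw [h5, ← h4] at h3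
    exact Nat.eq_of_mul_eq_mul_left Nat.card_pos h3
  have hCdvd : C.card ∣ (P : Subgroup G).index := by
    rw [hCcard]; exact Subgroup.index_dvd_of_le hPle
  have hC0 : C.card ≠ 0 := by rw [hCcard]; exact Subgroup.index_ne_zero_of_finite
  have hCp : C.card = p ^ C.card.primeFactorsList.length := by
    apply Nat.eq_prime_pow_of_unique_prime_dvd hC0
    intro r hr hrC
    have hrP := hrC.trans hCdvd
    rcases hpq r hr (hrP.trans (Subgroup.index_dvd_card _)) with h | h
    · exact absurd (h ▸ hrP) P.not_dvd_index
    · exact h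
  obtain ⟨d, ρ, ⟨h, hh⟩, l, hl⟩ := aux_exists_rep g hg C hC p _ hp hCp
  let Z : Subgroup G :=
    { carrier := {x | ∀ y, ρ x * ρ y = ρ y * ρ x}
      one_mem' := by intro y; simp
      mul_mem' := by
        intro a b ha hb y
        rw [map_mul, mul_assoc, hb y, ← mul_assoc, ha y, mul_assoc]
      inv_mem' := by
        intro a ha y
        have h1 : ρ a⁻¹ * ρ a = 1 := by rw [← map_mul]; simp
        have h2 : ρ a * ρ a⁻¹ = 1 := by rw [← map_mul]; simp
        calc ρ a⁻¹ * ρ y = ρ a⁻¹ * (ρ y * ρ a) * ρ a⁻¹ := by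
              rw [mul_assoc, mul_assoc, h2, mul_one]
          _ = ρ y * ρ a⁻¹ := by rw [← ha y, ← mul_assoc, h1, one_mul] }
  have hZn : Z.Normal := by
    refine ⟨fun x hx w y => ?_⟩
    have h2 : ρ w * ρ w⁻¹ = 1 := by rw [← map_mul]; simp
    have h3 : ρ (w * x * w⁻¹) = ρ x := by
      rw [map_mul, map_mul, ← hx w, mul_assoc, h2, mul_one]
    rw [h3]; exact hx y
  have hgZ : g ∈ Z := by
    intro y
    rw [hl]; exact Algebra.commutes _ _
  have hZt : Z = ⊤ := by
    rcases hsimple Z hZn with h | h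
    · rw [h] at hgZ; exact absurd (Subgroup.mem_bot.1 hgZ) hg
    · exact h
  rcases hsimple ρ.ker inferInstance with hk | hk
  · have hinj := (MonoidHom.ker_eq_bot_iff ρ).1 hk
    refine Group.isSolvable_of_comm fun a b => ?_
    apply hinj
    rw [map_mul, map_mul]
    have : a ∈ Z := by rw [hZt]; trivial
    exact this b
  · have : h ∈ ρ.ker := by rw [hk]; trivial
    exact absurd (MonoidHom.mem_ker.1 this) hh

theorem aux_burnside {p q : ℕ} (hp : p.Prime) (hq : q.Prime) : ∀ (n : ℕ) (G : Type*) [Group G] [Finite G],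
    Nat.card G = n → (∀ r : ℕ, r.Prime → r ∣ Nat.card G → r = p ∨ r = q) → Group.IsSolvable G := by
  intro n
  induction n using Nat.strong_induction_on with
  | _ n ih =>
    intro G _ _ hn hpq
    by_cases hsimple : ∀ N : Subgroup G, N.Normal → N = ⊥ ∨ N = ⊤
    · by_cases h1 : Nat.card G = 1
      · have := (Nat.card_eq_one_iff_unique.1 h1).1
        infer_instance
      · have hr := Nat.minFac_prime h1
        have hrd := Nat.minFac_dvd (Nat.card G)
        rcases hpq _ hr hrd with h | h
        · exact aux_normal_of_simple hp hq (h ▸ hrd) hpq hsimple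
        · exact aux_normal_of_simple hq hp (h ▸ hrd) (fun r h1 h2 => (hpq r h1 h2).symm) hsimple
    · push Not at hsimple
      obtain ⟨N, hN, hb, ht⟩ := hsimple
      have hmul := N.card_mul_index
      have hN1 : 1 < Nat.card N := by
        rw [N.one_lt_card_iff_ne_bot]; exact hb
      have hI1 : 1 < N.index := by
        have h0 : N.index ≠ 0 := Subgroup.index_ne_zero_of_finite
        have h1 : N.index ≠ 1 := fun h => ht (Subgroup.index_eq_one.1 h)
        omega
      have s1 : Group.IsSolvable N := ih (Nat.card N) (by rw [← hn]; nlinarith) N rfl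
        (fun r h1 h2 => hpq r h1 (h2.trans N.card_subgroup_dvd_card))
      have s2 : Group.IsSolvable (G ⧸ N) := ih N.index (by rw [← hn]; nlinarith) (G ⧸ N) rfl
        (fun r h1 h2 => hpq r h1 (h2.trans N.index_dvd_card))
      exact Group.isSolvable_of_ker_le_range N.subtype (QuotientGroup.mk' N) (by simp)

theorem aux_prime_index (H : Type*) [Group H] [Finite H] [Nontrivial H] [Group.IsSolvable H] :
    ∃ N : Subgroup H, N.index.Prime := by
  have hlt := Group.IsSolvable.commutator_lt_top_of_nontrivial H
  let A := Abelianization H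
  have hA : Nontrivial A := by
    have : (commutator H).index ≠ 1 := fun h => hlt.ne (Subgroup.index_eq_one.1 h)
    have h0 : (commutator H).index ≠ 0 := Subgroup.index_ne_zero_of_finite
    rw [← Finite.one_lt_card_iff_nontrivial]
    change 1 < (commutator H).index
    omega
  obtain ⟨M, hM⟩ : ∃ M : Subgroup A, IsCoatom M := by
    obtain ⟨M, hM, -⟩ := (eq_top_or_exists_le_coatom (⊥ : Subgroup A)).resolve_left bot_ne_top
    exact ⟨M, hM⟩
  have : IsSimpleGroup (A ⧸ M) := by
    have : Nontrivial (A ⧸ M) := QuotientGroup.nontrivial_iff.2 hM.1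
    refine ⟨fun K _ => ?_⟩
    have hle : M ≤ K.comap (QuotientGroup.mk' M) := by
      intro x hx
      rw [Subgroup.mem_comap, (QuotientGroup.eq_one_iff x).2 hx |> (fun h => (h : QuotientGroup.mk' M x = 1))]
      exact K.one_mem
    have hsur := QuotientGroup.mk'_surjective M
    rcases hM.le_iff.1 hle with h | h
    · right
      have := Subgroup.map_comap_eq_self_of_surjective hsur K
      rw [h, Subgroup.map_top_of_surjective _ hsur] at this
      exact this.symm
    · left
      have := Subgroup.map_comap_eq_self_of_surjective hsur K
      rw [h] at this
      rw [← this]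
      simp
  have hpr := IsSimpleGroup.prime_card (α := A ⧸ M)
  refine ⟨M.comap Abelianization.of, ?_⟩
  rw [Subgroup.index_comap_of_surjective _ QuotientGroup.mk_surjective]
  exact hpr

theorem aux_chain {G : Type*} [Group G] [Finite G] [Group.IsSolvable G] (P : Subgroup G → Prop)
    (htop : P ⊤) (hstep : ∀ H N : Subgroup G, N ≤ H → (N.relIndex H).Prime → P H → P N) : P ⊥ := by
  have key : ∀ n (H : Subgroup G), Nat.card H = n → P H → P ⊥ := by
    intro n
    induction n using Nat.strong_induction_on with
    | _ n ih =>
      intro H hn hP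
      by_cases hb : H = ⊥
      · rwa [hb] at hP
      · have : Nontrivial H := (Subgroup.nontrivial_iff_ne_bot H).2 hb
        obtain ⟨N, hN⟩ := aux_prime_index H
        have hsub : (N.map H.subtype).subgroupOf H = N := by
          rw [Subgroup.subgroupOf, Subgroup.comap_map_eq_self_of_injective H.subtype_injective]
        refine ih _ ?_ (N.map H.subtype) rfl (hstep H _ (Subgroup.map_subtype_le N) ?_ hP)
        · rw [← hn, Subgroup.card_map_of_injective H.subtype_injective, ← N.card_mul_index]
          have := hN.two_le
          have : 0 < Nat.card N := Nat.card_pos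
          nlinarith
        · rw [Subgroup.relIndex, hsub]; exact hN
  exact key _ ⊤ rfl htop

/-- The real algebraic numbers. -/
noncomputable abbrev auxS : IntermediateField ℚ ℝ := algebraicClosure ℚ ℝ

/-- The totally real numbers, as a subfield of the real algebraic numbers. -/
noncomputable def auxT0 : Subfield auxS :=
  ⨅ σ : auxS →+* ℂ, (Complex.ofRealHom.fieldRange).comap σ

/-- The field of totally real numbers. -/
noncomputable def auxT : Subfield ℝ := auxT0.map (algebraMap auxS ℝ)

theorem aux_mem_T0 (x : auxS) : x ∈ auxT0 ↔ ∀ σ : auxS →+* ℂ, (σ x).im = 0 := by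
  unfold auxT0
  rw [Subfield.mem_iInf]
  refine forall_congr' fun σ => ?_
  rw [Subfield.mem_comap, RingHom.mem_fieldRange]
  constructor
  · rintro ⟨r, hr⟩
    rw [← hr]; simp
  · intro h
    exact ⟨(σ x).re, Complex.ext (by simp) (by simp [h])⟩

theorem aux_mem_T (x : ℝ) : x ∈ auxT ↔ ∃ hx : x ∈ auxS, ∀ σ : auxS →+* ℂ, (σ ⟨x, hx⟩).im = 0 := by
  unfold auxT
  rw [Subfield.mem_map]
  constructor
  · rintro ⟨y, hy, rfl⟩
    exact ⟨y.2, (aux_mem_T0 _).1 hy⟩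
  · rintro ⟨hx, h⟩
    exact ⟨⟨x, hx⟩, (aux_mem_T0 _).2 h, rfl⟩

theorem aux_T_le_S {x : ℝ} (hx : x ∈ auxT) : x ∈ auxS := ((aux_mem_T x).1 hx).1

theorem aux_extend {F : Subfield ℝ} (hF : F ≤ auxT) (σ : F →+* ℂ) :
    ∃ τ : auxS →+* ℂ, ∀ (x : F), σ x = τ ⟨x, aux_T_le_S (hF x.2)⟩ := by
  let i : F →+* auxS :=
    { toFun := fun x => ⟨x, aux_T_le_S (hF x.2)⟩
      map_one' := rfl
      map_mul' := fun _ _ => rfl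
      map_zero' := rfl
      map_add' := fun _ _ => rfl }
  let _ : Algebra F auxS := i.toAlgebra
  let _ : Algebra F ℂ := σ.toAlgebra
  have : IsScalarTower ℚ F auxS := IsScalarTower.of_algebraMap_eq' (Subsingleton.elim _ _)
  have : Algebra.IsAlgebraic ℚ auxS := algebraicClosure.isAlgebraic ℚ ℝ
  have : Algebra.IsAlgebraic F auxS := Algebra.IsAlgebraic.tower_top (K := ℚ) F
  let τ : auxS →ₐ[F] ℂ := IsAlgClosed.lift
  exact ⟨τ, fun x => (τ.commutes x).symm⟩

theorem aux_totally_real {F : Subfield ℝ} (hF : F ≤ auxT) (σ : F →+* ℂ) (x : F) : (σ x).im = 0 := by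
  obtain ⟨τ, hτ⟩ := aux_extend hF σ
  rw [hτ]
  exact ((aux_mem_T _).1 (hF x.2)).2 τ

theorem aux_sqrt_mem {x y z : ℝ} (hx : x ∈ auxT) (hy : y ∈ auxT) (hz : z ∈ auxT) {w : ℝ}
    (hw : w ^ 2 = 2 / 3 * (x ^ 2 + y ^ 2 + z ^ 2)) : w ∈ auxT := by
  obtain ⟨hx1, hx2⟩ := (aux_mem_T _).1 hx
  obtain ⟨hy1, hy2⟩ := (aux_mem_T _).1 hy
  obtain ⟨hz1, hz2⟩ := (aux_mem_T _).1 hz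
  have hwS : w ∈ auxS := by
    have h2 : IsAlgebraic ℚ (w ^ 2) := by
      have : w ^ 2 ∈ auxT := by
        rw [hw]
        have h23 : (2 / 3 : ℝ) ∈ auxT := div_mem (ofNat_mem _ _) (ofNat_mem _ _)
        exact mul_mem h23 (add_mem (add_mem (pow_mem hx 2) (pow_mem hy 2)) (pow_mem hz 2))
      exact mem_algebraicClosure_iff.1 (aux_T_le_S this)
    exact mem_algebraicClosure_iff.2 (IsAlgebraic.of_pow (by norm_num) h2)
  refine (aux_mem_T _).2 ⟨hwS, fun σ => ?_⟩
  have hS : (⟨w, hwS⟩ : auxS) ^ 2 = (2 / 3) * (⟨x, hx1⟩ ^ 2 + ⟨y, hy1⟩ ^ 2 + ⟨z, hz1⟩ ^ 2) :=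
    Subtype.ext hw
  have h := congrArg σ hS
  simp only [map_pow, map_mul, map_add, map_div₀, map_ofNat] at h
  have hx3 := hx2 σ
  have hy3 := hy2 σ
  have hz3 := hz2 σ
  generalize σ ⟨w, hwS⟩ = W at *
  generalize σ ⟨x, hx1⟩ = X at *
  generalize σ ⟨y, hy1⟩ = Y at *
  generalize σ ⟨z, hz1⟩ = Z at *
  have hre := congrArg Complex.re h
  have him := congrArg Complex.im h
  simp [pow_two, hx3, hy3, hz3] at hre him
  by_contra hne
  have : W.re = 0 := by
    have : W.re * W.im = 0 := by linarith
    exact (mul_eq_zero.1 this).resolve_right hne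
  rw [this] at hre
  have := mul_self_pos.2 hne
  nlinarith [mul_self_nonneg X.re, mul_self_nonneg Y.re, mul_self_nonneg Z.re]

/-- The steps allowed in the tower. -/
def auxStep (E F : Subfield ℝ) : Prop :=
  ∃ h : E ≤ F,
        (Subfield.relDegree h = 2 ∧
          ∃ c : E,
            (∀ σ : E →+* ℂ, (σ c).im = 0 ∧ 0 < (σ c).re) ∧
            F = Subfield.closure (↑E ∪ {Real.sqrt (c : ℝ)})) ∨
        (Subfield.relDegree h = 3 ∧
          ∃ u : E, |(u : ℝ)| ≤ 1 ∧
            ∃ β : ℝ, 4 * β ^ 3 - 3 * β - (u : ℝ) = 0 ∧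
              F = Subfield.closure (↑E ∪ {β}))

/-- Allowed steps inside the totally real numbers. -/
def auxR (E F : Subfield ℝ) : Prop := F ≤ auxT ∧ auxStep E F

theorem aux_relDegree (E : Subfield ℝ) (x : ℝ) (f : Polynomial E) (hf : 2 ≤ f.natDegree)
    (hf3 : f.natDegree ≤ 3) (hroot : ∀ r : E, ¬ f.IsRoot r) (hx : Polynomial.aeval x f = 0)
    (h : E ≤ Subfield.closure (↑E ∪ {x})) : Subfield.relDegree h = f.natDegree := by
  have hf0 : f ≠ 0 := by rintro rfl; simp at hf
  have hirr : Irreducible f := by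
    rw [Polynomial.irreducible_iff_roots_eq_zero_of_degree_le_three hf hf3]
    refine Multiset.eq_zero_of_forall_notMem fun r hr => hroot r ?_
    exact Polynomial.isRoot_of_mem_roots hr
  have hint : IsIntegral E x := IsAlgebraic.isIntegral ⟨f, hf0, hx⟩
  have h1 : Module.finrank E (IntermediateField.adjoin E {x}) = f.natDegree := by
    rw [IntermediateField.adjoin.finrank hint]
    have h2 := minpoly.eq_of_irreducible hirr hx
    rw [← h2, Polynomial.natDegree_mul hf0 (by simpa using hf0)]
    simp
  rw [← h1]
  have h3 : Subfield.closure (↑E ∪ {x}) = (IntermediateField.adjoin E {x}).toSubfield := by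
    rw [IntermediateField.adjoin_toSubfield]
    congr 2
    ext y
    simp [Algebra.algebraMap_ofSubsemiring_apply]
  generalize Subfield.closure (↑E ∪ {x}) = K at *
  subst h3
  rfl

theorem aux_sqrt_step {E : Subfield ℝ} (hE : E ≤ auxT) {δ : ℝ} (hδ : δ ∈ auxT) (hδ2 : δ ^ 2 ∈ E) :
    ∃ F, E ≤ F ∧ F ≤ auxT ∧ δ ∈ F ∧ Relation.ReflTransGen auxR E F := by
  by_cases hδE : δ ∈ E
  · exact ⟨E, le_rfl, hE, hδE, .refl⟩
  have habs : ∀ K : Subfield ℝ, |δ| ∈ K ↔ δ ∈ K := by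
    intro K
    rcases abs_choice δ with h | h <;> rw [h]
    exact neg_mem_iff
  have hle : E ≤ Subfield.closure (↑E ∪ {|δ|}) := fun x hx => Subfield.subset_closure (Or.inl hx)
  have hFT : Subfield.closure (↑E ∪ {|δ|}) ≤ auxT := by
    rw [Subfield.closure_le]
    rintro x (hx | hx)
    · exact hE hx
    · rw [Set.mem_singleton_iff.1 hx]; exact (habs _).2 hδ
  refine ⟨_, hle, hFT, (habs _).1 (Subfield.subset_closure (Or.inr rfl)), .single ⟨hFT, hle, .inl ⟨?_, ⟨δ ^ 2, hδ2⟩, ?_, ?_⟩⟩⟩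
  · have hdeg : (Polynomial.X ^ 2 - Polynomial.C (⟨δ ^ 2, hδ2⟩ : E)).natDegree = 2 :=
      Polynomial.natDegree_X_pow_sub_C
    rw [aux_relDegree E |δ| (Polynomial.X ^ 2 - Polynomial.C ⟨δ ^ 2, hδ2⟩) (by rw [hdeg])
      (by rw [hdeg]; norm_num) ?_ ?_ hle, hdeg]
    · intro r hr
      have h1 : r ^ 2 - ⟨δ ^ 2, hδ2⟩ = 0 := by simpa [Polynomial.IsRoot] using hr
      have h2 : (r : ℝ) ^ 2 - δ ^ 2 = 0 := by simpa using congrArg Subtype.val h1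
      have h3 : ((r : ℝ) - δ) * (r + δ) = 0 := by linear_combination h2
      rcases mul_eq_zero.1 h3 with h | h
      · apply hδE; rw [← sub_eq_zero.1 h]; exact r.2
      · apply hδE; rw [show δ = -(r : ℝ) by linarith]; exact neg_mem r.2
    · simp [Algebra.algebraMap_ofSubsemiring_apply]
  · intro σ
    obtain ⟨τ, hτ⟩ := aux_extend hE σ
    obtain ⟨h1, h2⟩ := (aux_mem_T _).1 hδ
    have h3 : σ ⟨δ ^ 2, hδ2⟩ = τ ⟨δ, h1⟩ ^ 2 := by
      rw [hτ, ← map_pow]; rfl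
    have h4 := h2 τ
    have h5 : τ ⟨δ, h1⟩ ≠ 0 := by
      rw [map_ne_zero]
      intro h
      have : δ = 0 := congrArg Subtype.val h
      exact hδE (this ▸ zero_mem E)
    rw [h3]
    generalize τ ⟨δ, h1⟩ = w at *
    have h6 : w.re ≠ 0 := fun h => h5 (Complex.ext h h4)
    simp only [pow_two, Complex.mul_im, Complex.mul_re, h4]
    exact ⟨by ring, by have := mul_self_pos.2 h6; linarith⟩
  · rw [Real.sqrt_sq_eq_abs]

theorem aux_quad_step {E : Subfield ℝ} (hE : E ≤ auxT) {x b c : ℝ} (hx : x ∈ auxT) (hb : b ∈ E)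
    (hc : c ∈ E) (h : x ^ 2 + b * x + c = 0) :
    ∃ F, E ≤ F ∧ F ≤ auxT ∧ x ∈ F ∧ Relation.ReflTransGen auxR E F := by
  have h2 : (2 * x + b) ^ 2 ∈ E := by
    rw [show (2 * x + b) ^ 2 = b ^ 2 - 4 * c by linear_combination 4 * h]
    exact sub_mem (pow_mem hb 2) (mul_mem (ofNat_mem _ _) hc)
  obtain ⟨F, h1, h3, h4, h5⟩ := aux_sqrt_step hE
    (add_mem (mul_mem (ofNat_mem _ _) hx) (hE hb) : 2 * x + b ∈ auxT) h2
  refine ⟨F, h1, h3, ?_, h5⟩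
  rw [show x = ((2 * x + b) - b) / 2 by ring]
  exact div_mem (sub_mem h4 (h1 hb)) (ofNat_mem _ _)

theorem aux_cubic0 {E : Subfield ℝ} (hE : E ≤ auxT) {x y z : ℝ} (hx : x ∈ auxT) (hy : y ∈ auxT)
    (hz : z ∈ auxT) (h1 : x + y + z = 0) (h2 : x * y + y * z + z * x ∈ E) (h3 : x * y * z ∈ E) :
    ∃ F, E ≤ F ∧ F ≤ auxT ∧ x ∈ F ∧ Relation.ReflTransGen auxR E F := by
  by_cases hx0 : x = 0
  · exact ⟨E, le_rfl, hE, hx0 ▸ zero_mem E, .refl⟩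
  obtain rfl : z = -x - y := by linarith
  set z := -x - y with hzdef
  have hpos : 0 < 2 / 3 * (x ^ 2 + y ^ 2 + z ^ 2) := by positivity
  let s := Real.sqrt (2 / 3 * (x ^ 2 + y ^ 2 + z ^ 2))
  have hs2 : s ^ 2 = 2 / 3 * (x ^ 2 + y ^ 2 + z ^ 2) := Real.sq_sqrt hpos.le
  have hs0 : 0 < s := Real.sqrt_pos.2 hpos
  have hsT : s ∈ auxT := aux_sqrt_mem hx hy hz hs2
  have hs2' : s ^ 2 = -4 / 3 * (x * y + y * z + z * x) := by rw [hs2, hzdef]; ring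
  have hsE : s ^ 2 ∈ E := by
    rw [hs2']
    exact mul_mem (div_mem (neg_mem (ofNat_mem _ _)) (ofNat_mem _ _)) h2
  obtain ⟨F1, hEF, hF1, hsF, hR⟩ := aux_sqrt_step hE hsT hsE
  have hquad : y ∈ F1 ∨ z ∈ F1 → ∃ F, E ≤ F ∧ F ≤ auxT ∧ x ∈ F ∧ Relation.ReflTransGen auxR E F := by
    have : ∀ t : ℝ, t ∈ F1 → x ^ 2 + t * x + (x * y + y * z + z * x + t ^ 2) = 0 →
        ∃ F, E ≤ F ∧ F ≤ auxT ∧ x ∈ F ∧ Relation.ReflTransGen auxR E F := by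
      intro t ht heq
      obtain ⟨F, g1, g2, g3, g4⟩ := aux_quad_step hF1 hx ht (add_mem (hEF h2) (pow_mem ht 2)) heq
      exact ⟨F, hEF.trans g1, g2, g3, hR.trans g4⟩
    rintro (h | h)
    · exact this y h (by rw [hzdef]; ring)
    · exact this z h (by rw [hzdef]; ring)
  let u : ℝ := 4 * (x * y * z) / s ^ 3
  have hu : u ∈ F1 := div_mem (mul_mem (ofNat_mem _ _) (hEF h3)) (pow_mem hsF 3)
  have hus : u * s ^ 3 = 4 * (x * y * z) := by simp only [u]; field_simp
  have hβ : 4 * (x / s) ^ 3 - 3 * (x / s) - u = 0 := by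
    simp only [u]
    field_simp
    rw [hs2', hzdef]; ring
  have hu1 : |u| ≤ 1 := by
    rw [← sq_le_one_iff_abs_le_one]
    have h6 : u ^ 2 * (s ^ 2) ^ 3 = 16 * (x * y * z) ^ 2 := by
      linear_combination (u * s ^ 3 + 4 * (x * y * z)) * hus
    have h7 : 16 * (x * y * z) ^ 2 ≤ (s ^ 2) ^ 3 := by
      rw [hs2']
      have := sq_nonneg ((x - y) * (y - z) * (z - x))
      have h8 : ((x - y) * (y - z) * (z - x)) ^ 2 =
        -4 * (x * y + y * z + z * x) ^ 3 - 27 * (x * y * z) ^ 2 := by rw [hzdef]; ring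
      nlinarith
    have h9 : 0 < (s ^ 2) ^ 3 := by positivity
    rw [← h6] at h7
    by_contra hcon
    push Not at hcon
    nlinarith
  let f : Polynomial F1 := Polynomial.C 4 * Polynomial.X ^ 3 + Polynomial.C 0 * Polynomial.X ^ 2
    + Polynomial.C (-3) * Polynomial.X + Polynomial.C (-⟨u, hu⟩)
  have hdeg : f.natDegree = 3 := Polynomial.natDegree_cubic (by norm_num)
  by_cases hroot : ∃ r : F1, f.IsRoot r
  · obtain ⟨r, hr⟩ := hroot
    have h5 : 4 * r ^ 3 + (-3) * r + -⟨u, hu⟩ = 0 := by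
      simpa [f, Polynomial.IsRoot] using hr
    have h6 : 4 * (r : ℝ) ^ 3 + (-3) * r + -u = 0 := by
      have := congrArg Subtype.val h5
      push_cast at this
      exact this
    have h7 : ((r : ℝ) * s - x) * ((r * s - y) * (r * s - z)) = 0 := by
      have h8 : ((r : ℝ) * s - x) * ((r * s - y) * (r * s - z)) =
        (r * s) ^ 3 + (x * y + y * z + z * x) * (r * s) - x * y * z := by rw [hzdef]; ring
      rw [h8]
      have h9 : x * y + y * z + z * x = - 3 / 4 * s ^ 2 := by rw [hs2']; ring
      rw [h9]
      linear_combination s ^ 3 / 4 * h6 + hus / 4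
    have hrs : (r : ℝ) * s ∈ F1 := mul_mem r.2 hsF
    rcases mul_eq_zero.1 h7 with h | h
    · exact ⟨F1, hEF, hF1, by rw [← sub_eq_zero.1 h]; exact hrs, hR⟩
    rcases mul_eq_zero.1 h with h | h
    · exact hquad (.inl (by rw [← sub_eq_zero.1 h]; exact hrs))
    · exact hquad (.inr (by rw [← sub_eq_zero.1 h]; exact hrs))
  · have hle : F1 ≤ Subfield.closure (↑F1 ∪ {x / s}) := fun t ht => Subfield.subset_closure (Or.inl ht)
    have hFT : Subfield.closure (↑F1 ∪ {x / s}) ≤ auxT := by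
      rw [Subfield.closure_le]
      rintro t (ht | ht)
      · exact hF1 ht
      · rw [Set.mem_singleton_iff.1 ht]; exact div_mem hx hsT
    refine ⟨_, hEF.trans hle, hFT, ?_, hR.trans (.single ⟨hFT, hle, .inr ⟨?_, ⟨u, hu⟩, hu1, x / s, hβ, rfl⟩⟩)⟩
    · have h5 : x / s ∈ Subfield.closure (↑F1 ∪ {x / s}) := Subfield.subset_closure (Or.inr rfl)
      have h6 := mul_mem h5 (hle hsF)
      rwa [div_mul_cancel₀ _ hs0.ne'] at h6
    · rw [aux_relDegree F1 (x / s) f (by rw [hdeg]; norm_num) (by rw [hdeg])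
        (fun r hr => hroot ⟨r, hr⟩) ?_ hle, hdeg]
      simp only [f, map_add, map_mul, map_pow, Polynomial.aeval_C, Polynomial.aeval_X, map_neg, map_zero,
        map_ofNat]
      have : algebraMap F1 ℝ ⟨u, hu⟩ = u := rfl
      rw [this]
      linear_combination hβ

theorem aux_cubic {E : Subfield ℝ} (hE : E ≤ auxT) {x y z : ℝ} (hx : x ∈ auxT) (hy : y ∈ auxT)
    (hz : z ∈ auxT) (h1 : x + y + z ∈ E) (h2 : x * y + y * z + z * x ∈ E) (h3 : x * y * z ∈ E) :
    ∃ F, E ≤ F ∧ F ≤ auxT ∧ x ∈ F ∧ Relation.ReflTransGen auxR E F := by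
  have ht : (x + y + z) / 3 ∈ E := div_mem h1 (ofNat_mem _ _)
  set t := (x + y + z) / 3 with htdef
  have hsum : x + y + z = 3 * t := by rw [htdef]; ring
  obtain ⟨F, g1, g2, g3, g4⟩ := aux_cubic0 hE (sub_mem hx (hE ht)) (sub_mem hy (hE ht))
    (sub_mem hz (hE ht)) (by linarith)
    (by
      rw [show (x - t) * (y - t) + (y - t) * (z - t) + (z - t) * (x - t) =
        (x * y + y * z + z * x) - 3 * t ^ 2 by linear_combination (-2 * t) * hsum]
      exact sub_mem h2 (mul_mem (ofNat_mem _ _) (pow_mem ht 2)))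
    (by
      rw [show (x - t) * (y - t) * (z - t) =
        x * y * z - t * (x * y + y * z + z * x) + 2 * t ^ 3 by linear_combination t ^ 2 * hsum]
      exact add_mem (sub_mem h3 (mul_mem ht h2)) (mul_mem (ofNat_mem _ _) (pow_mem ht 3)))
  refine ⟨F, g1, g2, ?_, g4⟩
  have := add_mem g3 (g1 ht)
  simpa using this

theorem aux_root_mem_T {m : Polynomial ℚ} (hm0 : m ≠ 0)
    (htr : ∀ z : ℂ, Polynomial.aeval z m = 0 → z.im = 0) {y : ℝ} (hy : Polynomial.aeval y m = 0) :
    y ∈ auxT := by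
  have hyS : y ∈ auxS := mem_algebraicClosure_iff.2 ⟨m, hm0, hy⟩
  refine (aux_mem_T _).2 ⟨hyS, fun τ => htr _ ?_⟩
  have h1 : Polynomial.eval₂ (algebraMap ℚ auxS) ⟨y, hyS⟩ m = 0 := by
    apply (algebraMap auxS ℝ).injective
    rw [Polynomial.hom_eval₂, map_zero]
    exact hy
  have h2 := congrArg τ h1
  rw [Polynomial.hom_eval₂, map_zero] at h2
  rw [Polynomial.aeval_def, ← h2]
  congr 1
  exact Subsingleton.elim _ _

theorem aux_splits_real {m : Polynomial ℚ} (htr : ∀ z : ℂ, Polynomial.aeval z m = 0 → z.im = 0) :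
    (m.map (algebraMap ℚ ℝ)).Splits := by
  refine Polynomial.Splits.of_splits_map Complex.ofRealHom (IsAlgClosed.splits _) ?_
  intro z hz
  have h1 := Polynomial.isRoot_of_mem_roots hz
  rw [Polynomial.map_map, Polynomial.IsRoot, Polynomial.eval_map] at h1
  have h2 := htr z (by
    rw [Polynomial.aeval_def, ← h1]
    congr 1)
  exact ⟨z.re, Complex.ext (by simp) (by simp [h2])⟩

theorem aux_galois_key (L : IntermediateField ℚ ℝ) [FiniteDimensional ℚ L]
    (hL : ∀ x : L, (x : ℝ) ∈ auxT) (H N : Subgroup (L ≃ₐ[ℚ] L)) (hNH : N ≤ H)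
    (hidx : N.relIndex H = 2 ∨ N.relIndex H = 3) (E : Subfield ℝ) (hE : E ≤ auxT)
    (hEH : ∀ x : L, (∀ h ∈ H, h x = x) → (x : ℝ) ∈ E) :
    ∀ x : L, (∀ h ∈ N, h x = x) → ∃ F, E ≤ F ∧ F ≤ auxT ∧ (x : ℝ) ∈ F ∧
      Relation.ReflTransGen auxR E F := by
  classical
  have hfin : Fintype H := Fintype.ofFinite H
  intro x hx
  let St := MulAction.stabilizer H x
  have hle : N.subgroupOf H ≤ St := by
    intro h hh
    rw [MulAction.mem_stabilizer_iff]
    exact hx h hh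
  have hdvd : St.index ∣ N.relIndex H := Subgroup.index_dvd_of_le hle
  have hcases : St.index = 1 ∨ St.index = 2 ∨ St.index = 3 := by
    rcases hidx with h | h <;> rw [h] at hdvd
    · rcases (Nat.dvd_prime Nat.prime_two).1 hdvd with h | h <;> simp [h]
    · rcases (Nat.dvd_prime Nat.prime_three).1 hdvd with h | h <;> simp [h]
  have hcoeff : ∀ n, (((prodXSubSMul H L x).coeff n : L) : ℝ) ∈ E := by
    intro n
    apply hEH
    intro h hh
    exact prodXSubSMul.coeff H L x ⟨h, hh⟩ n
  have heval := prodXSubSMul.eval H L x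
  have hprod : ∀ k, St.index = k → ∃ f : Fin k → L,
      prodXSubSMul H L x = ∏ i, (Polynomial.X - Polynomial.C (f i)) := by
    intro k hk
    let e : (H ⧸ St) ≃ Fin k := Finite.equivFinOfCardEq hk
    refine ⟨fun i => MulAction.ofQuotientStabilizer H x (e.symm i), ?_⟩
    unfold prodXSubSMul
    exact Finset.prod_equiv e (by intro i; simp) (by intro i _; simp)
  rcases hcases with h | h | h
  · refine ⟨E, le_rfl, hE, hEH x ?_, .refl⟩
    intro g hg
    have : (⟨g, hg⟩ : H) ∈ St := by rw [Subgroup.index_eq_one.1 h]; trivial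
    exact MulAction.mem_stabilizer_iff.1 this
  · obtain ⟨f, hf⟩ := hprod 2 h
    rw [hf] at heval
    have hexp : prodXSubSMul H L x = Polynomial.C 0 * Polynomial.X ^ 3
        + Polynomial.C 1 * Polynomial.X ^ 2 + Polynomial.C (-(f 0 + f 1)) * Polynomial.X
        + Polynomial.C (f 0 * f 1) := by
      rw [hf, Fin.prod_univ_two]
      simp only [map_neg, map_add, map_mul, map_one, map_zero]
      ring
    have h0 := hcoeff 0
    have h1 := hcoeff 1
    rw [hexp] at h0 h1
    simp [Polynomial.coeff_X, Polynomial.coeff_C] at h0 h1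
    rw [Fin.prod_univ_two, Polynomial.eval_mul] at heval
    simp only [Polynomial.eval_sub, Polynomial.eval_X, Polynomial.eval_C] at heval
    have heval' : ((x : ℝ) - f 0) * (x - f 1) = 0 := by exact_mod_cast congrArg Subtype.val heval
    exact aux_quad_step hE (hL x) h1 h0 (by linear_combination heval')
  · obtain ⟨f, hf⟩ := hprod 3 h
    rw [hf] at heval
    have hexp : prodXSubSMul H L x = Polynomial.C 1 * Polynomial.X ^ 3
        + Polynomial.C (-(f 0 + f 1 + f 2)) * Polynomial.X ^ 2
        + Polynomial.C (f 0 * f 1 + f 1 * f 2 + f 2 * f 0) * Polynomial.X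
        + Polynomial.C (-(f 0 * f 1 * f 2)) := by
      rw [hf, Fin.prod_univ_three]
      simp only [map_neg, map_add, map_mul, map_one]
      ring
    have h0 := hcoeff 0
    have h1 := hcoeff 1
    have h2 := hcoeff 2
    have c0 := congrArg (fun q => Polynomial.coeff q 0) hexp
    have c1 := congrArg (fun q => Polynomial.coeff q 1) hexp
    have c2 := congrArg (fun q => Polynomial.coeff q 2) hexp
    simp only [Polynomial.coeff_add, Polynomial.coeff_C_mul, Polynomial.coeff_X_pow,
      Polynomial.coeff_X, Polynomial.coeff_C] at c0 c1 c2
    norm_num at c0 c1 c2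
    rw [c0] at h0
    rw [c1] at h1
    rw [c2] at h2
    push_cast at h0 h1 h2
    have e1 : (f 0 : ℝ) + f 1 + f 2 ∈ E := by
      convert neg_mem h2 using 1; ring
    have e3 : (f 0 : ℝ) * f 1 * f 2 ∈ E := by
      convert neg_mem h0 using 1; ring
    rw [Fin.prod_univ_three, Polynomial.eval_mul, Polynomial.eval_mul] at heval
    simp only [Polynomial.eval_sub, Polynomial.eval_X, Polynomial.eval_C] at heval
    rcases mul_eq_zero.1 heval with heval | heval
    · rcases mul_eq_zero.1 heval with heval | heval
      · rw [sub_eq_zero.1 heval]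
        exact aux_cubic hE (hL (f 0)) (hL (f 1)) (hL (f 2)) e1 h1 e3
      · rw [sub_eq_zero.1 heval]
        exact aux_cubic hE (hL (f 1)) (hL (f 2)) (hL (f 0)) (by convert e1 using 1; ring)
          (by convert h1 using 1; ring) (by convert e3 using 1; ring)
    · rw [sub_eq_zero.1 heval]
      exact aux_cubic hE (hL (f 2)) (hL (f 0)) (hL (f 1)) (by convert e1 using 1; ring)
          (by convert h1 using 1; ring) (by convert e3 using 1; ring)

theorem aux_prim {K : Type*} [Field K] [Algebra ℚ K] (φ : K →+* ℝ) (F : Subfield ℝ) (θ : K)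
    (hθ : IntermediateField.adjoin ℚ {θ} = ⊤) (h : φ θ ∈ F) (x : K) : φ x ∈ F := by
  have hq : ∀ q : ℚ, algebraMap ℚ K q ∈ F.comap φ := fun q => by
    rw [Subfield.mem_comap]
    have : φ (algebraMap ℚ K q) = (q : ℝ) := eq_ratCast (φ.comp (algebraMap ℚ K)) q
    rw [this]
    exact SubfieldClass.ratCast_mem F q
  have hle : IntermediateField.adjoin ℚ {θ} ≤ (F.comap φ).toIntermediateField hq := by
    rw [IntermediateField.adjoin_le_iff, Set.singleton_subset_iff]
    exact h
  rw [hθ] at hle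
  exact hle (IntermediateField.mem_top (x := x))

theorem aux_galois_step (L : IntermediateField ℚ ℝ) [FiniteDimensional ℚ L]
    (hL : ∀ x : L, (x : ℝ) ∈ auxT) (H N : Subgroup (L ≃ₐ[ℚ] L)) (hNH : N ≤ H)
    (hidx : N.relIndex H = 2 ∨ N.relIndex H = 3) (E : Subfield ℝ) (hE : E ≤ auxT)
    (hEH : ∀ x : L, (∀ h ∈ H, h x = x) → (x : ℝ) ∈ E) :
    ∃ F, E ≤ F ∧ F ≤ auxT ∧ (∀ x : L, (∀ h ∈ N, h x = x) → (x : ℝ) ∈ F) ∧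
      Relation.ReflTransGen auxR E F := by
  have hK : ∀ x : L, x ∈ IntermediateField.fixedField N ↔ ∀ h ∈ N, h x = x := fun x =>
    IntermediateField.mem_fixedField_iff N x
  obtain ⟨θ, hθ⟩ := Field.exists_primitive_element ℚ (IntermediateField.fixedField N)
  obtain ⟨F, g1, g2, g3, g4⟩ := aux_galois_key L hL H N hNH hidx E hE hEH θ ((hK _).1 θ.2)
  refine ⟨F, g1, g2, fun x hx => ?_, g4⟩
  exact aux_prim ((algebraMap L ℝ).comp (IntermediateField.fixedField N).toSubfield.subtype)
    F θ hθ g3 ⟨x, (hK x).2 hx⟩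

theorem aux_reach (α : ℝ) (halg : IsAlgebraic ℚ α)
    (htr : ∀ z : ℂ, Polynomial.aeval z (minpoly ℚ α) = 0 → z.im = 0)
    (a b : ℕ)
    (hdeg : Module.finrank ℚ (Polynomial.SplittingField (minpoly ℚ α)) = 2 ^ a * 3 ^ b) :
    ∃ F : Subfield ℝ, α ∈ F ∧ Relation.ReflTransGen auxR ⊥ F := by
  have hint := halg.isIntegral
  have hm0 := minpoly.ne_zero hint
  have hsplit := aux_splits_real htr
  let L : IntermediateField ℚ ℝ := IntermediateField.adjoin ℚ ((minpoly ℚ α).rootSet ℝ)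
  have hsf : Polynomial.IsSplittingField ℚ L (minpoly ℚ α) :=
    IntermediateField.adjoin_rootSet_isSplittingField hsplit
  have hfd : FiniteDimensional ℚ L := Polynomial.IsSplittingField.finiteDimensional L (minpoly ℚ α)
  have hgal : IsGalois ℚ L :=
    IsGalois.of_separable_splitting_field (p := minpoly ℚ α) (minpoly.irreducible hint).separable
  have hcard : Nat.card (L ≃ₐ[ℚ] L) = 2 ^ a * 3 ^ b := by
    rw [IsGalois.card_aut_eq_finrank, ← hdeg]
    exact (Polynomial.IsSplittingField.algEquiv L (minpoly ℚ α)).toLinearEquiv.finrank_eq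
  have hprimes : ∀ r : ℕ, r.Prime → r ∣ Nat.card (L ≃ₐ[ℚ] L) → r = 2 ∨ r = 3 := by
    intro r hr hrd
    rw [hcard] at hrd
    rcases (Nat.Prime.dvd_mul hr).1 hrd with h | h
    · exact .inl ((Nat.prime_dvd_prime_iff_eq hr Nat.prime_two).1 (hr.dvd_of_dvd_pow h))
    · exact .inr ((Nat.prime_dvd_prime_iff_eq hr Nat.prime_three).1 (hr.dvd_of_dvd_pow h))
  have hsol : Group.IsSolvable (L ≃ₐ[ℚ] L) :=
    aux_burnside Nat.prime_two Nat.prime_three _ _ rfl hprimes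
  have hLT : ∀ x : L, (x : ℝ) ∈ auxT := by
    let M : IntermediateField ℚ ℝ := auxT.toIntermediateField (fun q => by
      rw [eq_ratCast]; exact SubfieldClass.ratCast_mem _ q)
    have hle : L ≤ M := by
      rw [IntermediateField.adjoin_le_iff]
      intro y hy
      exact aux_root_mem_T hm0 htr (Polynomial.mem_rootSet.1 hy).2
    exact fun x => hle x.2
  have hαL : α ∈ L := IntermediateField.subset_adjoin _ _
    (Polynomial.mem_rootSet.2 ⟨hm0, minpoly.aeval _ _⟩)
  have hmain := aux_chain (G := L ≃ₐ[ℚ] L)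
    (fun H => ∃ F : Subfield ℝ, F ≤ auxT ∧ (∀ x : L, (∀ h ∈ H, h x = x) → (x : ℝ) ∈ F) ∧
      Relation.ReflTransGen auxR ⊥ F) ?_ ?_
  · obtain ⟨F, -, h2, h3⟩ := hmain
    refine ⟨F, h2 ⟨α, hαL⟩ ?_, h3⟩
    intro h hh
    rw [Subgroup.mem_bot.1 hh]; rfl
  · refine ⟨⊥, bot_le, fun x hx => ?_, .refl⟩
    have h1 : x ∈ (⊥ : IntermediateField ℚ L) := by
      rw [IsGalois.mem_bot_iff_fixed]
      exact fun f => hx f trivial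
    obtain ⟨q, hq⟩ := IntermediateField.mem_bot.1 h1
    rw [← hq]
    have : ((algebraMap ℚ L q : L) : ℝ) = (q : ℝ) := by rw [eq_ratCast (algebraMap ℚ L)]; simp
    rw [this]
    exact SubfieldClass.ratCast_mem _ q
  · rintro H N hNH hpr ⟨E, hE, hEH, hR⟩
    have hidx := hprimes _ hpr ((N.relIndex_dvd_card H).trans H.card_subgroup_dvd_card)
    obtain ⟨F, -, g2, g3, g4⟩ := aux_galois_step L hLT H N hNH hidx E hE hEH
    exact ⟨F, g2, g3, hR.trans g4⟩

theorem aux_tower {F : Subfield ℝ} (h : Relation.ReflTransGen auxR ⊥ F) :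
    ∃ (n : ℕ) (f : ℕ → Subfield ℝ), f 0 = ⊥ ∧ f n = F ∧ (∀ i ≤ n, f i ≤ auxT) ∧
      ∀ i < n, auxStep (f i) (f (i + 1)) := by
  induction h with
  | refl => exact ⟨0, fun _ => ⊥, rfl, rfl, fun _ _ => bot_le, fun i hi => absurd hi (by omega)⟩
  | @tail E F hE hEF ih =>
    obtain ⟨n, f, h0, hn, hT, hs⟩ := ih
    refine ⟨n + 1, fun i => if i ≤ n then f i else F, by simpa using h0, by simp, ?_, ?_⟩
    · intro i _
      dsimp only
      split_ifs with h
      · exact hT i h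
      · exact hEF.1
    · intro i hi
      dsimp only
      by_cases h : i = n
      · subst h
        simpa [hn] using hEF.2
      · rw [if_pos (by omega), if_pos (by omega)]
        exact hs i (by omega)

/-- A totally real algebraic number whose splitting field over ℚ has degree
`2^a·3^b` lies atop a tower of totally real subfields of ℝ starting at ℚ, in which each
step is either a quadratic extension by the square root of a totally positive element or
a cubic extension by a root of a trisection polynomial `4X³ - 3X - u`, `|u| ≤ 1`. -/
theorem totally_real_tower_of_bisections_and_trisections
    (α : ℝ) (halg : IsAlgebraic ℚ α)
    (htr : ∀ z : ℂ, Polynomial.aeval z (minpoly ℚ α) = 0 → z.im = 0)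
    (a b : ℕ)
    (hdeg : Module.finrank ℚ (Polynomial.SplittingField (minpoly ℚ α)) = 2 ^ a * 3 ^ b) :
    ∃ (n : ℕ) (F : Fin (n + 1) → Subfield ℝ),
      F 0 = ⊥ ∧
      α ∈ F (Fin.last n) ∧
      (∀ i, ∀ σ : F i →+* ℂ, ∀ x : F i, (σ x).im = 0) ∧
      ∀ i : Fin n, ∃ h : F i.castSucc ≤ F i.succ,
        (Subfield.relDegree h = 2 ∧
          ∃ c : F i.castSucc,
            (∀ σ : F i.castSucc →+* ℂ, (σ c).im = 0 ∧ 0 < (σ c).re) ∧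
            F i.succ = Subfield.closure (↑(F i.castSucc) ∪ {Real.sqrt (c : ℝ)})) ∨
        (Subfield.relDegree h = 3 ∧
          ∃ u : F i.castSucc, |(u : ℝ)| ≤ 1 ∧
            ∃ β : ℝ, 4 * β ^ 3 - 3 * β - (u : ℝ) = 0 ∧
              F i.succ = Subfield.closure (↑(F i.castSucc) ∪ {β})) := by
  obtain ⟨E, hα, hE⟩ := aux_reach α halg htr a b hdeg
  obtain ⟨n, f, h0, hn, hT, hs⟩ := aux_tower hE
  refine ⟨n, fun i => f i, h0, ?_, ?_, ?_⟩
  · simpa [hn] using hα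
  · intro i σ x
    exact aux_totally_real (hT i (by omega)) σ x
  · intro i
    exact hs i i.2
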